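/- In the two-qubit entanglement swapping setup, with the concurrence C(ρ) := sqrt(2·((tr ρ)² − tr(ρ²))), the average post-measurement concurrence satisfies ∑_{i : p_i>0} p_i · C(ρⁱ) ≤ 2·|a0·a1|·|b0·b1| · ∑_{i=1}^4 |uⁱ_{00}·uⁱ_{11} − uⁱ_{10}·uⁱ_{01}| ≤ 4·|a0·a1|·|b0·b1|. -/

import Mathlib

open Classical

/-- Concurrence C(ρ) = sqrt(2·((tr ρ)² − tr(ρ²))) of a matrix (real part of the
traces; for Hermitian matrices the traces are real). -/
noncomputable def conc {n : Type*} [Fintype n] (ρ : Matrix n n ℂ) : ℝ :=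
  Real.sqrt (2 * (((Matrix.trace ρ).re) ^ 2 - (Matrix.trace (ρ * ρ)).re))

open scoped ComplexConjugate

/-- The concurrence of a `2 × 2` matrix with real diagonal is `2 √(det ρ)`. -/
lemma conc_fin_two (ρ : Matrix (Fin 2) (Fin 2) ℂ) (h : ∀ k, (ρ k k).im = 0) :
    conc ρ = Real.sqrt (4 * ρ.det.re) := by
  have h0 := h 0
  have h1 := h 1
  simp only [conc, Matrix.trace_fin_two, Matrix.det_fin_two, Matrix.mul_apply, Fin.sum_univ_two,
    Complex.add_re, Complex.sub_re, Complex.mul_re, h0, h1]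
  congr 1
  ring

/-- The determinant of the unnormalized post-measurement state, scaled by a factor `c`. -/
lemma det_postMeasurement (a b : Fin 2 → ℂ) (v : Fin 2 × Fin 2 → ℂ) (c : ℝ)
    (ρ : Matrix (Fin 2) (Fin 2) ℂ)
    (hρ : ∀ k k', ρ k k' = (c : ℂ) * (a k * conj (a k') *
      ∑ m : Fin 2, conj (v (k, m)) * v (k', m) * ((‖b m‖ ^ 2 : ℝ) : ℂ))) :
    ρ.det = ((c * (‖a 0 * a 1‖ * ‖b 0 * b 1‖ *
      ‖v (0, 0) * v (1, 1) - v (1, 0) * v (0, 1)‖)) ^ 2 : ℝ) := by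
  simp only [mul_pow, Complex.ofReal_mul, Complex.ofReal_pow, ← Complex.conj_mul', map_mul, map_sub,
    Matrix.det_fin_two, hρ, Fin.sum_univ_two]
  ring

/-- The diagonal of the post-measurement state is real. -/
lemma im_diag_postMeasurement (z : ℂ) (b w : Fin 2 → ℂ) (c : ℝ) :
    ((c : ℂ) * (z * conj z * ∑ m : Fin 2, conj (w m) * w m * ((‖b m‖ ^ 2 : ℝ) : ℂ))).im = 0 := by
  simp only [Complex.mul_conj', Complex.conj_mul']
  norm_cast

/-- A unit vector of `ℂ² ⊗ ℂ²` has coefficient determinant at most `1 / 2`. -/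
lemma norm_coeff_det_le (v : Fin 2 × Fin 2 → ℂ) (hv : ∑ x, conj (v x) * v x = 1) :
    ‖v (0, 0) * v (1, 1) - v (1, 0) * v (0, 1)‖ ≤ 1 / 2 := by
  have h : ∑ x, ‖v x‖ ^ 2 = 1 := by
    simp only [Complex.conj_mul'] at hv
    exact_mod_cast hv
  simp only [Fintype.sum_prod_type, Fin.sum_univ_two] at h
  have hd := norm_sub_le (v (0, 0) * v (1, 1)) (v (1, 0) * v (0, 1))
  rw [norm_mul, norm_mul] at hd
  nlinarith [sq_nonneg (‖v (0, 0)‖ - ‖v (1, 1)‖), sq_nonneg (‖v (1, 0)‖ - ‖v (0, 1)‖)]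

/-- Bound on the average post-measurement concurrence in two-qubit entanglement
swapping. -/
theorem avg_concurrence_le
    (a b : Fin 2 → ℂ)
    (ha : ‖a 0‖ ^ 2 + ‖a 1‖ ^ 2 = 1) (hb : ‖b 0‖ ^ 2 + ‖b 1‖ ^ 2 = 1)
    (u : Fin 4 → Fin 2 × Fin 2 → ℂ)
    (hu : ∀ i j : Fin 4,
      ∑ x : Fin 2 × Fin 2, (starRingEnd ℂ) (u i x) * u j x = if i = j then 1 else 0)
    (p : Fin 4 → ℝ)
    (hp : ∀ i, p i = ∑ x : Fin 2 × Fin 2, ‖u i x‖ ^ 2 * ‖a x.1‖ ^ 2 * ‖b x.2‖ ^ 2)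
    (ρ : Fin 4 → Matrix (Fin 2) (Fin 2) ℂ)
    (hρ : ∀ i, ∀ k k' : Fin 2, ρ i k k' = ((p i : ℝ) : ℂ)⁻¹ *
      (a k * (starRingEnd ℂ) (a k') *
        ∑ m : Fin 2, (starRingEnd ℂ) (u i (k, m)) * u i (k', m) * ((‖b m‖ ^ 2 : ℝ) : ℂ))) :
    (∑ i ∈ Finset.univ.filter (fun i => 0 < p i), p i * conc (ρ i) ≤
      2 * ‖a 0 * a 1‖ * ‖b 0 * b 1‖ *
        ∑ i : Fin 4, ‖u i (0, 0) * u i (1, 1) - u i (1, 0) * u i (0, 1)‖) ∧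
    (2 * ‖a 0 * a 1‖ * ‖b 0 * b 1‖ *
        ∑ i : Fin 4, ‖u i (0, 0) * u i (1, 1) - u i (1, 0) * u i (0, 1)‖ ≤
      4 * (‖a 0 * a 1‖ * ‖b 0 * b 1‖)) := by
  have hbound : ∑ i : Fin 4, ‖u i (0, 0) * u i (1, 1) - u i (1, 0) * u i (0, 1)‖ ≤ 2 :=
    (Finset.sum_le_sum fun i _ => norm_coeff_det_le (u i) (by simpa using hu i i)).trans
      (by norm_num)
  have hterm : ∀ i, 0 < p i → p i * conc (ρ i) = 2 * ‖a 0 * a 1‖ * ‖b 0 * b 1‖ *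
      ‖u i (0, 0) * u i (1, 1) - u i (1, 0) * u i (0, 1)‖ := by
    intro i hi
    have hρi := hρ i
    simp only [← Complex.ofReal_inv] at hρi
    rw [conc_fin_two (ρ i) fun k => by
        rw [hρi]; exact im_diag_postMeasurement (a k) b (fun m => u i (k, m)) _,
      det_postMeasurement a b (u i) _ _ hρi, Complex.ofReal_re,
      show (4 : ℝ) = 2 ^ 2 by norm_num, ← mul_pow, Real.sqrt_sq (by positivity)]
    field_simp
  constructor
  · rw [Finset.mul_sum, Finset.sum_congr rfl fun i hi => hterm i (Finset.mem_filter.mp hi).2]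
    exact Finset.sum_le_sum_of_subset_of_nonneg (Finset.filter_subset _ _)
      fun i _ _ => by positivity
  · nlinarith [mul_le_mul_of_nonneg_left hbound
      (by positivity : 0 ≤ 2 * ‖a 0 * a 1‖ * ‖b 0 * b 1‖)]
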